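/- arXiv:1909.10210 — 2 statements merged into one kernel-verified Lean document; each statement's English description precedes it below -/
import Mathlib

section
/- Let k ≥ 3 be an integer and let R be an associative ring with 1 that is Lie nilpotent of index k. Let N be the two-sided ideal of R generated by all elements [x₁,x₂,…,x_k]_k with x₁,…,x_k ∈ R. Then N² = {0}; that is, uv = 0 for all u, v ∈ N. -/
/-- `lnc a [x₁,…,x_m]` is the left-normed commutator `[…[[a,x₁],x₂],…,x_m]`,
where `[a,b] = a*b - b*a`. -/
def lnc {R : Type*} [Ring R] : R → List R → R
  | a, [] => a
  | a, x :: l => lnc (a * x - x * a) l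

/-- `LNC k x` is the left-normed commutator `[x 0, x 1, …, x k]` of the `k+1`
elements `x 0, …, x k`. -/
def LNC {R : Type*} [Ring R] (k : ℕ) (x : ℕ → R) : R :=
  lnc (x 0) ((List.range k).map fun i => x (i + 1))

/-- A ring `R` is Lie nilpotent of index `k` if all left-normed commutators of
any `k+1` of its elements vanish. -/
def LieNilpotentOfIndex (R : Type*) [Ring R] (k : ℕ) : Prop :=
  ∀ x : ℕ → R, LNC k x = 0

theorem lnc_append {R : Type*} [Ring R] (a : R) (l₁ l₂ : List R) :
    lnc a (l₁ ++ l₂) = lnc (lnc a l₁) l₂ := by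
  induction l₁ generalizing a with
  | nil => rfl
  | cons x l ih => exact ih _

theorem LNC_succ {R : Type*} [Ring R] (m : ℕ) (x : ℕ → R) :
    LNC (m + 1) x = LNC m x * x (m + 1) - x (m + 1) * LNC m x := by
  simp [LNC, List.range_succ, lnc_append, lnc]

theorem LNC_congr {R : Type*} [Ring R] (m : ℕ) {x y : ℕ → R} (h : ∀ i ≤ m, x i = y i) :
    LNC m x = LNC m y := by
  induction m with
  | zero => exact h 0 le_rfl
  | succ m ih => rw [LNC_succ, LNC_succ, ih fun i hi => h i (by omega), h _ le_rfl]

/-- Commuting a left-normed commutator with one more element gives a left-normed commutator. -/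
theorem exists_LNC_succ {R : Type*} [Ring R] (m : ℕ) (x : ℕ → R) (y : R) :
    ∃ z : ℕ → R, LNC (m + 1) z = LNC m x * y - y * LNC m x := by
  have h : LNC m (Function.update x (m + 1) y) = LNC m x :=
    LNC_congr m fun i hi => Function.update_of_ne (by omega) _ _
  exact ⟨_, by rw [LNC_succ, h, Function.update_self]⟩

/-- If `[a, y]` is central for every `y`, then `[a, x] [b, y] = 0` whenever `b = [c, d]`. -/
theorem comm_mul_comm_eq_zero {R : Type*} [Ring R] {a : R}
    (ha : ∀ y z, Commute (a * y - y * a) z) (x y c d : R) :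
    (a * x - x * a) * ((c * d - d * c) * y - y * (c * d - d * c)) = 0 := by
  have hab : a * (c * d - d * c) - (c * d - d * c) * a = 0 := by
    have h₁ := sub_eq_zero.2 (ha c d).eq
    have h₂ := sub_eq_zero.2 (ha d c).eq
    calc
      _ = ((a * c - c * a) * d - d * (a * c - c * a))
          - ((a * d - d * a) * c - c * (a * d - d * a)) := by noncomm_ring
      _ = 0 := by rw [h₁, h₂, sub_zero]
  generalize c * d - d * c = b at hab ⊢
  have h₁ := sub_eq_zero.2 (ha (x * b) y).eq
  have h₂ := sub_eq_zero.2 (ha x y).eq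
  have h₃ : a * (x * b) - x * b * a = (a * x - x * a) * b :=
    calc
      _ = (a * x - x * a) * b + x * (a * b - b * a) := by noncomm_ring
      _ = _ := by rw [hab, mul_zero, add_zero]
  rw [h₃] at h₁
  calc
    _ = ((a * x - x * a) * b * y - y * ((a * x - x * a) * b))
        - ((a * x - x * a) * y - y * (a * x - x * a)) * b := by noncomm_ring
    _ = 0 := by rw [h₁, h₂, zero_mul, sub_zero]

/-- A two-sided ideal generated by central elements with pairwise zero products squares to zero. -/
theorem TwoSidedIdeal.mul_eq_zero_of_mem_span {R : Type*} [Ring R] {S : Set R}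
    (hc : ∀ s ∈ S, ∀ r, Commute s r) (hS : ∀ s ∈ S, ∀ t ∈ S, s * t = 0)
    {u v : R} (hu : u ∈ TwoSidedIdeal.span S) (hv : v ∈ TwoSidedIdeal.span S) : u * v = 0 := by
  have hl : ∀ t ∈ S, u * t = 0 := fun t ht => by
    induction hu using TwoSidedIdeal.span_induction with
    | mem s hs => exact hS s hs t ht
    | zero => exact zero_mul t
    | add x y _ _ hx hy => rw [add_mul, hx, hy, add_zero]
    | neg x _ hx => rw [neg_mul, hx, neg_zero]
    | left_absorb r x _ hx => rw [mul_assoc, hx, mul_zero]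
    | right_absorb r x _ hx => rw [mul_assoc, ← (hc t ht r).eq, ← mul_assoc, hx, zero_mul]
  have hr : ∀ r, u * r * v = 0 := by
    induction hv using TwoSidedIdeal.span_induction with
    | mem t ht => exact fun r => by rw [mul_assoc, ← (hc t ht r).eq, ← mul_assoc, hl t ht, zero_mul]
    | zero => exact fun r => mul_zero _
    | add x y _ _ hx hy => exact fun r => by rw [mul_add, hx, hy, add_zero]
    | neg x _ hx => exact fun r => by rw [mul_neg, hx, neg_zero]
    | left_absorb q x _ hx => exact fun r => by rw [← mul_assoc, mul_assoc u, hx]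
    | right_absorb q x _ hx => exact fun r => by rw [← mul_assoc, hx, zero_mul]
  simpa using hr 1

/-- **Jennings' theorem, ideal form.** If `k ≥ 3` and `R` is Lie nilpotent of index `k`,
and `N` is the two-sided ideal of `R` generated by all left-normed commutators
`[x₁,…,x_k]_k` of `k` elements, then `N² = {0}`, i.e. `u * v = 0` for all `u, v ∈ N`. -/
theorem sq_of_ideal_spanned_by_leftNormedComm_eq_zero
    (k : ℕ) (hk : 3 ≤ k) (R : Type*) [Ring R] (hL : LieNilpotentOfIndex R k)
    (N : TwoSidedIdeal R) (hN : N = TwoSidedIdeal.span {u | ∃ x : ℕ → R, u = LNC (k - 1) x})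
    (u v : R) (hu : u ∈ N) (hv : v ∈ N) :
    u * v = 0 := by
  obtain ⟨m, rfl⟩ : ∃ m, k = m + 3 := ⟨k - 3, by omega⟩
  have central : ∀ (x : ℕ → R) (r : R), Commute (LNC (m + 2) x) r := fun x r => by
    obtain ⟨z, hz⟩ := exists_LNC_succ (m + 2) x r
    exact sub_eq_zero.1 (hz.symm.trans (hL z))
  subst hN
  refine TwoSidedIdeal.mul_eq_zero_of_mem_span ?_ ?_ hu hv
  · rintro _ ⟨x, rfl⟩ r
    exact central x r
  · rintro _ ⟨x, rfl⟩ _ ⟨y, rfl⟩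
    change LNC (m + 2) x * LNC (m + 2) y = 0
    rw [LNC_succ (m + 1) x, LNC_succ (m + 1) y, LNC_succ m y]
    refine comm_mul_comm_eq_zero (fun y z => ?_) _ _ _ _
    obtain ⟨w, hw⟩ := exists_LNC_succ (m + 1) x y
    exact hw ▸ central w z
end

section
/- Let R be an associative ring with 1 in which n·1 is invertible, and suppose R is Lie nilpotent of index k. Let A be an n×n matrix over R and let λ₀^{(k)}, λ₁^{(k)}, …, λ_{n^k}^{(k)} ∈ R be the coefficients of the k-th right characteristic polynomial p_{A,k}(x) = λ₀^{(k)} + λ₁^{(k)}x + ⋯ + λ_{n^k}^{(k)}x^{n^k}. Then the right Cayley–Hamilton identity Iₙ·λ₀^{(k)} + A·λ₁^{(k)} + A²·λ₂^{(k)} + ⋯ + A^{n^k}·λ_{n^k}^{(k)} = 0 holds, where A^i·λ denotes the product of A^i with the scalar matrix λ·Iₙ. -/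
/-- The symmetric determinant. -/
def sdet {R : Type*} [Ring R] {n : ℕ} (A : Matrix (Fin n) (Fin n) R) : R :=
  ∑ α : Equiv.Perm (Fin n), ∑ β : Equiv.Perm (Fin n),
    ((Equiv.Perm.sign α * Equiv.Perm.sign β : ℤˣ) : ℤ) •
      (List.ofFn fun i => A (α i) (β i)).prod

/-- The symmetric adjoint. -/
def sadj {R : Type*} [Ring R] {n : ℕ} (A : Matrix (Fin (n + 1)) (Fin (n + 1)) R) :
    Matrix (Fin (n + 1)) (Fin (n + 1)) R :=
  fun r s => (-1 : R) ^ ((r : ℕ) + (s : ℕ)) * sdet (A.submatrix s.succAbove r.succAbove)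

/-- `adjAux A j = (P_j, P₁ * ⋯ * P_j)` where `(P_j)` is the right adjoint sequence of `A`. -/
def adjAux {R : Type*} [Ring R] {n : ℕ} (A : Matrix (Fin (n + 1)) (Fin (n + 1)) R) :
    ℕ → Matrix (Fin (n + 1)) (Fin (n + 1)) R × Matrix (Fin (n + 1)) (Fin (n + 1)) R
  | 0 => (1, 1)
  | j + 1 =>
      let q := adjAux A j
      let p := sadj (A * q.2)
      (p, q.2 * p)

/-- The product `P₁ * ⋯ * P_k` of the right adjoint sequence of `A`. -/
def radjProd {R : Type*} [Ring R] {n : ℕ} (A : Matrix (Fin (n + 1)) (Fin (n + 1)) R)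
    (k : ℕ) : Matrix (Fin (n + 1)) (Fin (n + 1)) R :=
  (adjAux A k).2

/-- The `k`-th right adjoint `radj_{(k)}(A) = n • (P₁ * ⋯ * P_k)`. -/
def radj {R : Type*} [Ring R] {n : ℕ} (A : Matrix (Fin (n + 1)) (Fin (n + 1)) R)
    (k : ℕ) : Matrix (Fin (n + 1)) (Fin (n + 1)) R :=
  (n + 1) • radjProd A k

/-- The `k`-th right determinant `rdet_{(k)}(A) = tr (A * P₁ * ⋯ * P_k)`. -/
def rdet {R : Type*} [Ring R] {n : ℕ} (A : Matrix (Fin (n + 1)) (Fin (n + 1)) R)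
    (k : ℕ) : R :=
  (A * radjProd A k).trace

/-- The `k`-th right characteristic polynomial `p_{A,k}(x) = rdet_{(k)}(x Iₙ - A)`. -/
noncomputable def rcharpoly {R : Type*} [Ring R] {n : ℕ}
    (A : Matrix (Fin (n + 1)) (Fin (n + 1)) R) (k : ℕ) : Polynomial R :=
  rdet ((Polynomial.X : Polynomial R) • (1 : Matrix (Fin (n + 1)) (Fin (n + 1)) (Polynomial R))
    - A.map Polynomial.C) k

section Commutators

variable {R : Type*} [Ring R]

/-- The additive subgroup generated by all commutators `a * b - b * a`. -/
def commSubgroup (R : Type*) [Ring R] : AddSubgroup R :=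
  AddSubgroup.closure {z | ∃ a b : R, z = a * b - b * a}

/-- The additive subgroup generated by all `[c, b]` with `c` in `commSubgroup R`. -/
def commSubgroup₃ (R : Type*) [Ring R] : AddSubgroup R :=
  AddSubgroup.closure {z | ∃ c ∈ commSubgroup R, ∃ b : R, z = c * b - b * c}

theorem comm_mem (a b : R) : a * b - b * a ∈ commSubgroup R :=
  AddSubgroup.subset_closure ⟨a, b, rfl⟩

theorem comm_mem₃ {c : R} (hc : c ∈ commSubgroup R) (b : R) :
    c * b - b * c ∈ commSubgroup₃ R :=
  AddSubgroup.subset_closure ⟨c, hc, b, rfl⟩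

theorem comm_mem₃' (a : R) {c : R} (hc : c ∈ commSubgroup R) :
    a * c - c * a ∈ commSubgroup₃ R := by
  simpa using neg_mem (comm_mem₃ hc a)

theorem mul_central_mem₃ {z : R} (hz : z ∈ Subring.center R) {a : R}
    (ha : a ∈ commSubgroup₃ R) : a * z ∈ commSubgroup₃ R := by
  rw [Subring.mem_center_iff] at hz
  induction ha using AddSubgroup.closure_induction with
  | mem a ha =>
    obtain ⟨c, hc, b, rfl⟩ := ha
    convert comm_mem₃ hc (b * z) using 1
    rw [sub_mul, mul_assoc, mul_assoc b c z, hz c, mul_assoc]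
  | zero => simp
  | add a b _ _ iha ihb => rw [add_mul]; exact add_mem iha ihb
  | neg a _ iha => rw [neg_mul]; exact neg_mem iha

/-- Modulo `[[R, R], R]`, the element `[r, u[x, y]]` does not change under the cyclic
permutation `(r, u, x) ↦ (x, r, u)`. -/
theorem comm_mul_comm_sub_mem₃ (r u x y : R) :
    (r * (u * (x * y - y * x)) - u * (x * y - y * x) * r) -
      (x * (r * (u * y - y * u)) - r * (u * y - y * u) * x) ∈ commSubgroup₃ R := by
  convert add_mem (comm_mem₃' r (comm_mem (u * x) y)) (comm_mem₃ (comm_mem u y) (x * r)) using 1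
  noncomm_ring

/-- `[r, u[x, y]] ∈ [[R, R], R]` whenever `[r, u] ∈ [[R, R], R]`. -/
theorem comm_mul_comm_mem₃ {r u : R} (hu : r * u - u * r ∈ commSubgroup₃ R) (x y : R) :
    r * (u * (x * y - y * x)) - u * (x * y - y * x) * r ∈ commSubgroup₃ R := by
  have key : ∀ d ∈ commSubgroup₃ R, y * (x * d) - x * d * y ∈ commSubgroup₃ R := by
    intro d hd
    induction hd using AddSubgroup.closure_induction with
    | mem a ha =>
      obtain ⟨c, hc, b, rfl⟩ := ha
      convert add_mem (comm_mul_comm_sub_mem₃ y x c b)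
        (comm_mem₃ hc (y * (x * b - b * x))) using 1
      noncomm_ring
    | zero => simp
    | add a b _ _ iha ihb => convert add_mem iha ihb using 1; noncomm_ring
    | neg a _ iha => convert neg_mem iha using 1; noncomm_ring
  convert sub_mem (sub_mem (comm_mul_comm_sub_mem₃ r u x y) (comm_mul_comm_sub_mem₃ x r y u))
    (key _ hu) using 1
  noncomm_ring

theorem comm_mem₃_of_mem_closure (r : R) {u : R}
    (hu : u ∈ Subring.closure
      ({r} ∪ (Subring.center R : Set R) ∪ (commSubgroup R : Set R))) :
    r * u - u * r ∈ commSubgroup₃ R := by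
  rw [Subring.mem_closure_iff] at hu
  induction hu using AddSubgroup.closure_induction with
  | zero => simp
  | add a b _ _ iha ihb => convert add_mem iha ihb using 1; noncomm_ring
  | neg a _ iha => convert neg_mem iha using 1; noncomm_ring
  | mem u hu =>
    suffices h : ∀ i : ℕ, r * (r ^ i * u) - r ^ i * u * r ∈ commSubgroup₃ R by simpa using h 0
    induction hu using Submonoid.closure_induction_right with
    | one => intro i; simp [← pow_succ, ← pow_succ']
    | mul_right u _ g hg ih =>
      intro i
      obtain (rfl | hg) | hg := hg
      · have h := comm_mem₃' g (comm_mem (g ^ i * u) g)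
        have := add_mem h (ih (i + 1))
        convert this using 1
        rw [pow_succ']
        noncomm_ring
      · convert mul_central_mem₃ hg (ih i) using 1
        rw [SetLike.mem_coe, Subring.mem_center_iff] at hg
        rw [← mul_assoc (r ^ i), mul_assoc _ g r, ← hg r]
        noncomm_ring
      · rw [SetLike.mem_coe] at hg
        induction hg using AddSubgroup.closure_induction with
        | mem g hg =>
          obtain ⟨x, y, rfl⟩ := hg
          have := comm_mul_comm_mem₃ (ih i) x y
          rwa [← mul_assoc (r ^ i)]
        | zero => simp
        | add a b _ _ iha ihb => convert add_mem iha ihb using 1; noncomm_ring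
        | neg a _ iha => convert neg_mem iha using 1; noncomm_ring

/-- In the subring generated by `r`, the centre and `[R, R]`, all commutators lie in
`[[R, R], R]`. -/
theorem comm_mem₃_of_mem_closure₂ (r : R) {u v : R}
    (hu : u ∈ Subring.closure
      ({r} ∪ (Subring.center R : Set R) ∪ (commSubgroup R : Set R)))
    (hv : v ∈ Subring.closure
      ({r} ∪ (Subring.center R : Set R) ∪ (commSubgroup R : Set R))) :
    u * v - v * u ∈ commSubgroup₃ R := by
  induction hu using Subring.closure_induction generalizing v with
  | mem g hg =>
    obtain (rfl | hg) | hg := hg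
    · exact comm_mem₃_of_mem_closure _ hv
    · rw [SetLike.mem_coe, Subring.mem_center_iff] at hg
      simp [hg v]
    · exact comm_mem₃ hg v
  | zero => simp
  | one => simp
  | add a b _ _ iha ihb => convert add_mem (iha hv) (ihb hv) using 1; noncomm_ring
  | neg a _ iha => convert neg_mem (iha hv) using 1; noncomm_ring
  | mul a b ha hb iha ihb =>
    convert add_mem (iha (mul_mem hb hv)) (ihb (mul_mem hv ha)) using 1
    noncomm_ring

end Commutators

section LeftNormed

variable {R : Type*} [Ring R]

theorem lnc_add (a b : R) (l : List R) : lnc (a + b) l = lnc a l + lnc b l := by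
  induction l generalizing a b with
  | nil => rfl
  | cons x l ih => simp only [lnc]; rw [← ih]; congr 1; noncomm_ring

/-- The left-normed commutator as an additive map in its first argument. -/
def lncHom (l : List R) : R →+ R :=
  AddMonoidHom.mk' (fun a => lnc a l) fun a b => lnc_add a b l

theorem lncHom_apply (l : List R) (a : R) : lncHom l a = lnc a l := rfl

theorem map_lnc {S : Type*} [Ring S] (f : S →+* R) (a : S) (l : List S) :
    f (lnc a l) = lnc (f a) (l.map f) := by
  induction l generalizing a with
  | nil => rfl
  | cons x l ih => simp [lnc, ih]

theorem lieNilpotentOfIndex_iff {k : ℕ} :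
    LieNilpotentOfIndex R k ↔ ∀ (a : R) (l : List R), l.length = k → lnc a l = 0 := by
  constructor
  · rintro h a l rfl
    convert h fun i => (a :: l).getD i 0
    rw [LNC]
    congr 1
    refine List.ext_getElem (by simp) fun i h₁ h₂ => ?_
    simp [h₁]
  · intro h x
    exact h _ _ (by simp)

theorem LieNilpotentOfIndex.commSubgroup_eq_zero (h : LieNilpotentOfIndex R 1) {a : R}
    (ha : a ∈ commSubgroup R) : a = 0 := by
  rw [lieNilpotentOfIndex_iff] at h
  induction ha using AddSubgroup.closure_induction with
  | mem a ha => obtain ⟨x, y, rfl⟩ := ha; exact h x [y] rfl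
  | zero => rfl
  | add a b _ _ iha ihb => simp [iha, ihb]
  | neg a _ iha => simp [iha]

theorem LieNilpotentOfIndex.lnc_eq_zero {k : ℕ} (h : LieNilpotentOfIndex R (k + 2)) {a : R}
    (ha : a ∈ commSubgroup₃ R) (l : List R) (hl : l.length = k) : lnc a l = 0 := by
  rw [lieNilpotentOfIndex_iff] at h
  suffices commSubgroup₃ R ≤ (lncHom l).ker from this ha
  refine (AddSubgroup.closure_le _).2 ?_
  rintro _ ⟨c, hc, b, rfl⟩
  suffices commSubgroup R ≤ (lncHom (b :: l)).ker from this hc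
  refine (AddSubgroup.closure_le _).2 ?_
  rintro _ ⟨x, y, rfl⟩
  exact h x (y :: b :: l) (by simp [hl])

theorem LieNilpotentOfIndex.subring_closure {k : ℕ} (h : LieNilpotentOfIndex R (k + 2))
    (r : R) :
    LieNilpotentOfIndex (Subring.closure
      ({r} ∪ (Subring.center R : Set R) ∪ (commSubgroup R : Set R))) (k + 1) := by
  rw [lieNilpotentOfIndex_iff]
  rintro a (_ | ⟨b, l⟩) hl
  · simp at hl
  · refine Subtype.ext ?_
    have := map_lnc (Subring.subtype _) a (b :: l)
    rw [Subring.subtype_apply] at this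
    rw [this]
    exact h.lnc_eq_zero (comm_mem₃_of_mem_closure₂ r a.2 b.2) _
      (by rw [List.length_map]; exact Nat.succ.inj hl)

open Polynomial in
theorem lnc_polynomial_eq_zero {m : ℕ} {p : R[X]}
    (hp : ∀ (i : ℕ) (l : List R), l.length = m → lnc (p.coeff i) l = 0)
    (l : List R[X]) (hl : l.length = m) : lnc p l = 0 := by
  induction l generalizing p m with
  | nil => exact Polynomial.ext fun i => hp i [] hl
  | cons q l ih =>
    subst hl
    refine ih (m := l.length) (fun i l' hl' => ?_) rfl
    rw [coeff_sub, coeff_mul, coeff_mul, ← Finset.Nat.sum_antidiagonal_swap,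
      ← Finset.sum_sub_distrib, ← lncHom_apply, map_sum]
    exact Finset.sum_eq_zero fun x _ => hp x.2 (q.coeff x.1 :: l') (by simp [hl'])

theorem LieNilpotentOfIndex.polynomial {k : ℕ} (h : LieNilpotentOfIndex R k) :
    LieNilpotentOfIndex (Polynomial R) k := by
  rw [lieNilpotentOfIndex_iff] at h ⊢
  exact fun _ => lnc_polynomial_eq_zero fun i => h _

end LeftNormed

section SymmetricDeterminant

open Equiv Matrix

variable {R : Type*} [Ring R] {n : ℕ}

/-- The permutation of `Fin (n + 1)` with `0 ↦ p` that acts as `e` between the complements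
of `0` and of `p`, both identified with `Fin n` in increasing order. -/
def permSuccAbove (p : Fin (n + 1)) (e : Perm (Fin n)) : Perm (Fin (n + 1)) :=
  p.cycleRange.symm * Perm.decomposeFin.symm (0, e)

theorem permSuccAbove_zero (p : Fin (n + 1)) (e : Perm (Fin n)) : permSuccAbove p e 0 = p := by
  simp [permSuccAbove]

theorem permSuccAbove_succ (p : Fin (n + 1)) (e : Perm (Fin n)) (i : Fin n) :
    permSuccAbove p e i.succ = p.succAbove (e i) := by
  simp [permSuccAbove]

theorem sign_permSuccAbove (p : Fin (n + 1)) (e : Perm (Fin n)) :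
    Perm.sign (permSuccAbove p e) = (-1) ^ (p : ℕ) * Perm.sign e := by
  rw [permSuccAbove, Perm.sign_mul, Perm.decomposeFin.symm_sign, Perm.sign_symm,
    Fin.sign_cycleRange]
  simp

theorem bijective_permSuccAbove :
    Function.Bijective fun x : Fin (n + 1) × Perm (Fin n) => permSuccAbove x.1 x.2 := by
  rw [Fintype.bijective_iff_injective_and_card]
  refine ⟨?_, by simp [Fintype.card_perm, Nat.factorial_succ]⟩
  rintro ⟨p, e⟩ ⟨q, f⟩ h
  have h0 : p = q := by simpa [permSuccAbove_zero] using congrArg (fun σ => σ 0) h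
  subst h0
  refine Prod.ext rfl (Equiv.ext fun i => ?_)
  have := congrArg (fun σ => σ i.succ) h
  simpa [permSuccAbove_succ] using this

theorem sum_perm_succ {M : Type*} [AddCommMonoid M] (f : Perm (Fin (n + 1)) → M) :
    ∑ σ, f σ = ∑ p, ∑ e, f (permSuccAbove p e) := by
  rw [← Fintype.sum_prod_type', ← bijective_permSuccAbove.sum_comp]

/-- The summand of `sdet` belonging to `α` and `β`. -/
def sdetTerm (A : Matrix (Fin n) (Fin n) R) (α β : Perm (Fin n)) : R :=
  ((Perm.sign α * Perm.sign β : ℤˣ) : ℤ) • (List.ofFn fun i => A (α i) (β i)).prod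

theorem sdet_eq (A : Matrix (Fin n) (Fin n) R) : sdet A = ∑ α, ∑ β, sdetTerm A α β := rfl

/-- The part of `sdet A` in which the `p`-th factor is taken from row `s`. -/
def sdetPart (A : Matrix (Fin n) (Fin n) R) (p s : Fin n) : R :=
  ∑ α : Perm (Fin n), ∑ β, if α p = s then sdetTerm A α β else 0

theorem sum_sdetPart_row (A : Matrix (Fin n) (Fin n) R) (p : Fin n) :
    ∑ s, sdetPart A p s = sdet A := by
  simp_rw [sdetPart, sdet_eq]
  rw [Finset.sum_comm]
  refine Finset.sum_congr rfl fun α _ => ?_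
  rw [Finset.sum_comm]
  simp

theorem sum_sdetPart_pos (A : Matrix (Fin n) (Fin n) R) (s : Fin n) :
    ∑ p, sdetPart A p s = sdet A := by
  simp_rw [sdetPart, sdet_eq]
  rw [Finset.sum_comm]
  refine Finset.sum_congr rfl fun α _ => ?_
  rw [Finset.sum_comm]
  refine Finset.sum_congr rfl fun β _ => ?_
  simp [← Equiv.eq_symm_apply]

theorem sdetTerm_permSuccAbove (A : Matrix (Fin (n + 1)) (Fin (n + 1)) R) (p q : Fin (n + 1))
    (e f : Perm (Fin n)) :
    sdetTerm A (permSuccAbove p e) (permSuccAbove q f) =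
      A p q * ((-1) ^ ((q : ℕ) + (p : ℕ)) *
        sdetTerm (A.submatrix p.succAbove q.succAbove) e f) := by
  rw [sdetTerm, sdetTerm, sign_permSuccAbove, sign_permSuccAbove, List.ofFn_succ, List.prod_cons]
  simp only [permSuccAbove_zero, permSuccAbove_succ, submatrix_apply]
  rw [mul_mul_mul_comm, ← pow_add, add_comm (q : ℕ)]
  obtain h | h := Nat.even_or_odd ((p : ℕ) + q) <;> simp [h.neg_one_pow, -zsmul_eq_mul]

theorem sdetPart_zero (A : Matrix (Fin (n + 1)) (Fin (n + 1)) R) (s : Fin (n + 1)) :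
    sdetPart A 0 s = ∑ t, A s t * ((-1) ^ ((t : ℕ) + (s : ℕ)) *
      sdet (A.submatrix s.succAbove t.succAbove)) := by
  simp_rw [sdetPart, sum_perm_succ, sdetTerm_permSuccAbove, permSuccAbove_zero, sdet_eq,
    Finset.mul_sum]
  rw [Finset.sum_eq_single s (fun p _ hp => by simp [hp]) (by simp)]
  simp only [if_true]
  rw [Finset.sum_comm]

theorem mul_sadj_apply (A : Matrix (Fin (n + 1)) (Fin (n + 1)) R) (r s : Fin (n + 1)) :
    (A * sadj A) r s = sdetPart (A.updateRow s (A r)) 0 s := by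
  rw [sdetPart_zero, mul_apply]
  simp_rw [submatrix_updateRow_succAbove, updateRow_self]
  rfl

theorem trace_mul_sadj (A : Matrix (Fin (n + 1)) (Fin (n + 1)) R) :
    (A * sadj A).trace = sdet A := by
  simp [trace, mul_sadj_apply, sum_sdetPart_row]

theorem sdet_eq_zero_of_row_eq {A : Matrix (Fin n) (Fin n) R} {r s : Fin n} (hrs : r ≠ s)
    (h : A r = A s) : sdet A = 0 := by
  rw [sdet_eq]
  refine Finset.sum_involution (fun α _ => swap r s * α) (fun α _ => ?_) (fun α _ _ => ?_)
    (fun _ _ => Finset.mem_univ _) fun α _ => swap_mul_self_mul r s α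
  · rw [← Finset.sum_add_distrib]
    refine Finset.sum_eq_zero fun β _ => ?_
    have hA : ∀ i, A (swap r s i) = A i := fun i => by
      rw [swap_apply_def]; split_ifs with h₁ h₂ <;> simp [*]
    simp [sdetTerm, Perm.sign_swap hrs, hA]
  · simpa [mul_eq_right] using hrs

theorem map_sdetTerm_rotate {M : Type*} [AddCommGroup M] {φ : R →+ M}
    (hφ : ∀ a b, φ (a * b) = φ (b * a)) (A : Matrix (Fin (n + 1)) (Fin (n + 1)) R)
    (α β : Perm (Fin (n + 1))) :
    φ (sdetTerm A (α * finRotate (n + 1)) (β * finRotate (n + 1))) = φ (sdetTerm A α β) := by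
  rw [sdetTerm, sdetTerm, Perm.sign_mul, Perm.sign_mul, mul_mul_mul_comm, Int.units_mul_self,
    mul_one, map_zsmul, map_zsmul, List.ofFn_succ', List.ofFn_succ, List.concat_eq_append,
    List.prod_append, hφ]
  simp [Fin.coeSucc_eq_succ]

theorem map_sdetPart {M : Type*} [AddCommGroup M] {φ : R →+ M}
    (hφ : ∀ a b, φ (a * b) = φ (b * a)) (A : Matrix (Fin (n + 1)) (Fin (n + 1)) R)
    (p s : Fin (n + 1)) : φ (sdetPart A p s) = φ (sdetPart A 0 s) := by
  induction p using Fin.induction with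
  | zero => rfl
  | succ i ih =>
    rw [← ih]
    simp only [sdetPart, map_sum]
    symm
    rw [← Equiv.sum_comp (Equiv.mulRight (finRotate (n + 1)))]
    refine Finset.sum_congr rfl fun α _ => ?_
    rw [← Equiv.sum_comp (Equiv.mulRight (finRotate (n + 1)))]
    refine Finset.sum_congr rfl fun β _ => ?_
    simp only [coe_mulRight, Perm.mul_apply, finRotate_apply, Fin.coeSucc_eq_succ]
    split_ifs
    · exact map_sdetTerm_rotate hφ A α β
    · rfl

theorem nsmul_map_mul_sadj_apply {M : Type*} [AddCommGroup M] {φ : R →+ M}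
    (hφ : ∀ a b, φ (a * b) = φ (b * a)) (A : Matrix (Fin (n + 1)) (Fin (n + 1)) R)
    (r s : Fin (n + 1)) :
    (n + 1) • φ ((A * sadj A) r s) = φ (sdet (A.updateRow s (A r))) := by
  rw [← sum_sdetPart_pos _ s, map_sum, mul_sadj_apply]
  simp [map_sdetPart hφ]

/-- Modulo commutators, `n • (A * A*)` is the scalar matrix of `tr (A * A*)`. -/
theorem nsmul_mul_sadj_sub_mem (A : Matrix (Fin (n + 1)) (Fin (n + 1)) R) (r s : Fin (n + 1)) :
    ((n + 1) • (A * sadj A) - (A * sadj A).trace • (1 : Matrix (Fin (n + 1)) (Fin (n + 1)) R)) r s ∈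
      commSubgroup R := by
  have hφ : ∀ a b : R, QuotientAddGroup.mk' (commSubgroup R) (a * b) =
      QuotientAddGroup.mk' (commSubgroup R) (b * a) := fun a b => by
    rw [← sub_eq_zero, ← map_sub, ← AddMonoidHom.mem_ker, QuotientAddGroup.ker_mk']
    exact comm_mem a b
  rw [← QuotientAddGroup.ker_mk' (commSubgroup R), AddMonoidHom.mem_ker, Matrix.sub_apply, Matrix.smul_apply,
    map_sub, map_nsmul, nsmul_map_mul_sadj_apply hφ, trace_mul_sadj, ← map_sub]
  obtain rfl | hrs := eq_or_ne r s
  · simp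
  · rw [sdet_eq_zero_of_row_eq hrs (by simp [updateRow_ne hrs])]
    simp [hrs]

theorem map_sdet {S : Type*} [Ring S] (f : S →+* R) (A : Matrix (Fin n) (Fin n) S) :
    sdet (A.map f) = f (sdet A) := by
  simp [sdet, map_list_prod, List.map_ofFn, Function.comp_def]

theorem map_sadj {S : Type*} [Ring S] (f : S →+* R) (A : Matrix (Fin (n + 1)) (Fin (n + 1)) S) :
    sadj (A.map f) = (sadj A).map f := by
  ext r s
  simp [sadj, ← map_sdet, submatrix_map]

theorem radjProd_zero (A : Matrix (Fin (n + 1)) (Fin (n + 1)) R) : radjProd A 0 = 1 := rfl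

theorem radjProd_succ (A : Matrix (Fin (n + 1)) (Fin (n + 1)) R) (k : ℕ) :
    radjProd A (k + 1) = radjProd A k * sadj (A * radjProd A k) := rfl

theorem radjProd_succ' (A : Matrix (Fin (n + 1)) (Fin (n + 1)) R) (k : ℕ) :
    radjProd A (k + 1) = sadj A * radjProd (A * sadj A) k := by
  induction k with
  | zero => simp [radjProd_succ, radjProd_zero]
  | succ k ih => rw [radjProd_succ, ih, radjProd_succ, mul_assoc, mul_assoc]

theorem map_radjProd {S : Type*} [Ring S] (f : S →+* R)
    (A : Matrix (Fin (n + 1)) (Fin (n + 1)) S) (k : ℕ) :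
    radjProd (A.map f) k = (radjProd A k).map f := by
  induction k with
  | zero => simp [radjProd_zero]
  | succ k ih => rw [radjProd_succ, ih, radjProd_succ, ← Matrix.map_mul, map_sadj, Matrix.map_mul]

end SymmetricDeterminant

section RightDeterminant

open Matrix

universe u

/-- Over a Lie nilpotent ring of index `k` with `1/n`, the matrix
`n • (A * P₁ * ⋯ * P_k)` is the scalar matrix of `rdet_{(k)}(A)`. -/
theorem nsmul_mul_radjProd {R : Type u} [Ring R] {n k : ℕ} (hn : IsUnit ((n + 1 : ℕ) : R))
    (hL : LieNilpotentOfIndex R (k + 1)) (A : Matrix (Fin (n + 1)) (Fin (n + 1)) R) :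
    (n + 1) • (A * radjProd A (k + 1)) = rdet A (k + 1) • (1 : Matrix (Fin (n + 1)) (Fin (n + 1)) R) := by
  induction k generalizing R with
  | zero =>
    rw [rdet, radjProd_succ', radjProd_zero, mul_one, ← sub_eq_zero]
    ext r s
    exact hL.commSubgroup_eq_zero (nsmul_mul_sadj_sub_mem A r s)
  | succ k ih =>
    set r := (A * sadj A).trace
    let S := Subring.closure
      ({r} ∪ (Subring.center R : Set R) ∪ (commSubgroup R : Set R))
    obtain ⟨v, hv, hv'⟩ := isUnit_iff_exists.1 hn
    have hvS : v ∈ S := Subring.subset_closure <| Or.inl <| Or.inr <| by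
      rw [SetLike.mem_coe, Subring.mem_center_iff]
      intro g
      calc g * v = v * (((n + 1 : ℕ) : R) * g) * v := by rw [← mul_assoc v, hv', one_mul]
        _ = v * g := by rw [Nat.cast_comm, mul_assoc, mul_assoc, hv, mul_one]
    have hrS : r ∈ S := Subring.subset_closure <| Or.inl <| Or.inl rfl
    have hB : ∀ i j, (A * sadj A) i j ∈ S := by
      intro i j
      have h₁ : (r • (1 : Matrix (Fin (n + 1)) (Fin (n + 1)) R)) i j ∈ S := by
        rw [Matrix.smul_apply, smul_eq_mul, Matrix.one_apply]
        split_ifs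
        · simpa using hrS
        · simp
      have h₂ : ((n + 1) • (A * sadj A) - r • (1 : Matrix (Fin (n + 1)) (Fin (n + 1)) R)) i j ∈ S :=
        Subring.subset_closure <| Or.inr <| nsmul_mul_sadj_sub_mem A i j
      have h₃ := mul_mem hvS (add_mem h₂ h₁)
      rwa [← Matrix.add_apply, sub_add_cancel, Matrix.smul_apply, nsmul_eq_mul, ← mul_assoc, hv',
        one_mul] at h₃
    let B : Matrix (Fin (n + 1)) (Fin (n + 1)) S := fun i j => ⟨(A * sadj A) i j, hB i j⟩
    have hBmap : B.map S.subtype = A * sadj A := rfl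
    have hnS : IsUnit ((n + 1 : ℕ) : S) :=
      isUnit_iff_exists.2 ⟨⟨v, hvS⟩, Subtype.ext (by simpa using hv),
        Subtype.ext (by simpa using hv')⟩
    have h := congrArg (fun X => X.map S.subtype) (ih hnS (hL.subring_closure r) B)
    have hprod : A * radjProd A (k + 1 + 1) = (B * radjProd B (k + 1)).map S.subtype := by
      rw [radjProd_succ', ← mul_assoc, Matrix.map_mul, ← map_radjProd, hBmap]
    rw [rdet, hprod]
    ext i j
    have hij := congrFun (congrFun h i) j
    simp only [Matrix.map_apply, Matrix.smul_apply, map_nsmul, smul_eq_mul, map_mul] at hij ⊢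
    rw [hij, rdet, trace, trace, map_sum, Matrix.one_apply, Matrix.one_apply]
    split_ifs <;> simp

end RightDeterminant

section CayleyHamilton

open Matrix Polynomial

variable {R : Type*} [Ring R] {n : ℕ}

theorem natDegree_sdet_le {A : Matrix (Fin n) (Fin n) R[X]} {d : ℕ}
    (hA : ∀ i j, (A i j).natDegree ≤ d) : (sdet A).natDegree ≤ n * d := by
  refine natDegree_sum_le_of_forall_le _ _ fun α _ =>
    natDegree_sum_le_of_forall_le _ _ fun β _ => (natDegree_smul_le _ _).trans ?_
  refine (natDegree_list_prod_le _).trans ?_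
  refine (List.sum_le_card_nsmul _ d ?_).trans (by simp)
  simpa using fun i => hA (α i) (β i)

theorem natDegree_sadj_le {A : Matrix (Fin (n + 1)) (Fin (n + 1)) R[X]} {d : ℕ}
    (hA : ∀ i j, (A i j).natDegree ≤ d) (r s : Fin (n + 1)) :
    (sadj A r s).natDegree ≤ n * d := by
  have h : (sdet (A.submatrix s.succAbove r.succAbove)).natDegree ≤ n * d :=
    natDegree_sdet_le fun i j => hA _ _
  rw [sadj]
  obtain h' | h' := neg_one_pow_eq_or R[X] ((r : ℕ) + s) <;> simpa [h'] using h

theorem natDegree_matrix_mul_le {A B : Matrix (Fin n) (Fin n) R[X]} {d e : ℕ}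
    (hA : ∀ i j, (A i j).natDegree ≤ d) (hB : ∀ i j, (B i j).natDegree ≤ e) (i j : Fin n) :
    ((A * B) i j).natDegree ≤ d + e := by
  rw [mul_apply]
  exact natDegree_sum_le_of_forall_le _ _ fun t _ =>
    natDegree_mul_le.trans (add_le_add (hA i t) (hB t j))

theorem natDegree_radjProd_lt {A : Matrix (Fin (n + 1)) (Fin (n + 1)) R[X]}
    (hA : ∀ i j, (A i j).natDegree ≤ 1) (k : ℕ) (r s : Fin (n + 1)) :
    (radjProd A k r s).natDegree < (n + 1) ^ k := by
  induction k generalizing r s with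
  | zero =>
    rw [radjProd_zero, Matrix.one_apply]
    split_ifs <;> simp
  | succ k ih =>
    obtain ⟨d, hd⟩ : ∃ d, (n + 1) ^ k = d + 1 :=
      Nat.exists_eq_add_one.2 (by positivity)
    rw [hd] at ih
    have hQ : ∀ i j, (radjProd A k i j).natDegree ≤ d := fun i j => Nat.lt_succ_iff.1 (ih i j)
    have h := natDegree_matrix_mul_le hQ
      (natDegree_sadj_le (natDegree_matrix_mul_le hA hQ)) r s
    rw [radjProd_succ, pow_succ, hd]
    refine h.trans_lt ?_
    nlinarith

/-- If `(xI - A) Q` is the scalar matrix of a polynomial `p`, then `A` is a right root of `p`. -/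
theorem sum_pow_mul_coeff_eq_zero {A : Matrix (Fin n) (Fin n) R}
    {Q : Matrix (Fin n) (Fin n) R[X]} {p : R[X]}
    (h : ((X : R[X]) • (1 : Matrix (Fin n) (Fin n) R[X]) - A.map C) * Q = p • 1) {N : ℕ}
    (hQ : ∀ i j, (Q i j).natDegree < N) :
    ∑ i ∈ Finset.range (N + 1), A ^ i * (p.coeff i • (1 : Matrix (Fin n) (Fin n) R)) = 0 := by
  let q : ℕ → Matrix (Fin n) (Fin n) R := fun m => Q.map fun f => f.coeff m
  have hp : ∀ m, p.coeff m • (1 : Matrix (Fin n) (Fin n) R) =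
      (((X : R[X]) • Q).map fun f => f.coeff m) - A * q m := by
    intro m
    ext i j
    have := congrArg (fun f => f.coeff m) (congrFun (congrFun h i) j)
    rw [sub_mul, smul_mul_assoc, one_mul] at this
    simp only [Matrix.sub_apply, coeff_sub, Matrix.smul_apply, smul_eq_mul, mul_apply, Matrix.map_apply,
      finsetSum_coeff, coeff_C_mul, Matrix.one_apply] at this ⊢
    change _ = _ - ∑ t, A i t * (Q t j).coeff m
    rw [this]
    split_ifs <;> simp
  have key : ∀ N, ∑ i ∈ Finset.range (N + 1),
      A ^ i * (p.coeff i • (1 : Matrix (Fin n) (Fin n) R)) = -(A ^ (N + 1) * q N) := by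
    intro N
    induction N with
    | zero =>
      have h0 : (((X : R[X]) • Q).map fun f => f.coeff 0) = 0 := by ext; simp
      simp [hp, h0]
    | succ N ih =>
      have h0 : (((X : R[X]) • Q).map fun f => f.coeff (N + 1)) = q N := by ext; simp [q]
      rw [Finset.sum_range_succ, ih, hp, h0, mul_sub, ← mul_assoc, ← pow_succ]
      abel
  have hqN : q N = 0 := by
    ext i j
    exact coeff_eq_zero_of_natDegree_lt (hQ i j)
  rw [key, hqN, mul_zero, neg_zero]

end CayleyHamilton

/-- **The Lie nilpotent right Cayley–Hamilton theorem.** If `1/n ∈ R` and `R` is Lie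
nilpotent of index `k`, then for an `n×n` matrix `A` (`n ≥ 1`) with `k`-th right
characteristic polynomial `p_{A,k}(x) = λ₀ + λ₁x + ⋯ + λ_{n^k}x^(n^k)` one has
`Iₙλ₀ + Aλ₁ + A²λ₂ + ⋯ + A^(n^k)λ_{n^k} = 0`, where `A^i·λ` is the product of `A^i`
with the scalar matrix `λ·Iₙ`. -/
theorem rightCayleyHamilton
    (R : Type*) [Ring R] (n k : ℕ) (hn : IsUnit ((n + 1 : ℕ) : R))
    (hL : LieNilpotentOfIndex R k)
    (A : Matrix (Fin (n + 1)) (Fin (n + 1)) R) :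
    ∑ i ∈ Finset.range ((n + 1) ^ k + 1),
      A ^ i * ((rcharpoly A k).coeff i • (1 : Matrix (Fin (n + 1)) (Fin (n + 1)) R)) = 0 := by

  obtain _ | k := k
  · have : Subsingleton R := subsingleton_of_forall_eq 0 fun a => hL fun _ => a
    exact Subsingleton.elim _ _
  · set M : Matrix (Fin (n + 1)) (Fin (n + 1)) (Polynomial R) :=
      (Polynomial.X : Polynomial R) • 1 - A.map Polynomial.C with hM
    have hu : IsUnit ((n + 1 : ℕ) : Polynomial R) := by
      simpa using hn.map (Polynomial.C : R →+* Polynomial R)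
    refine sum_pow_mul_coeff_eq_zero (Q := (n + 1) • radjProd M (k + 1)) ?_ fun i j => ?_
    · rw [mul_smul_comm]
      exact nsmul_mul_radjProd hu hL.polynomial M
    · refine (Polynomial.natDegree_smul_le _ _).trans_lt
        (natDegree_radjProd_lt (fun i j => ?_) (k + 1) i j)
      rw [hM, Matrix.sub_apply, Matrix.smul_apply, Matrix.map_apply, Matrix.one_apply]
      refine (Polynomial.natDegree_sub_le _ _).trans (max_le ?_ (by simp))
      split_ifs <;> simp [Polynomial.natDegree_X_le]
end
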